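/- Let P ⊆ ℝ^d be a simple d-dimensional k-template (d ≥ 1, k ≥ 2). Then χ(L(ℝ^d,P)) equals the least cardinal κ such that κ^{+(d−1)} ≥ 2^{ℵ₀}. -/

import Mathlib

open Cardinal

/-- A hypergraph with vertex type `V` is identified with its set of edges
`E : Set (Set V)`.  It is `κ`-colorable if there is a function from `V` to a
set of cardinality at most `κ` that is not constant on any edge. -/
def HGColorable {V : Type} (E : Set (Set V)) (κ : Cardinal) : Prop :=
  ∃ (α : Type) (φ : V → α), #α ≤ κ ∧ ∀ e ∈ E, ∃ x ∈ e, ∃ y ∈ e, φ x ≠ φ y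

/-- The chromatic number of a hypergraph: the least cardinal `κ` such that it
has a proper `κ`-coloring. -/
noncomputable def chrNum {V : Type} (E : Set (Set V)) : Cardinal :=
  sInf {κ | HGColorable E κ}

/-- `cardSucc κ m = κ^{+m}`, the `m`-fold cardinal successor of `κ`. -/
noncomputable def cardSucc (κ : Cardinal) (m : ℕ) : Cardinal := (Order.succ)^[m] κ

/-- `Q` is a homomorphic image of the set `P` of `d`-tuples: there is a
surjection `f : P → Q` such that `x i = y i` implies `f x i = f y i`. -/
def IsHomImage {d : ℕ} {A : Type} {B : Fin d → Type} (P : Set (Fin d → A))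
    (Q : Set (∀ i, B i)) : Prop :=
  ∃ f : (Fin d → A) → (∀ i, B i),
    Set.MapsTo f P Q ∧ Set.SurjOn f P Q ∧
    ∀ x ∈ P, ∀ y ∈ P, ∀ i, x i = y i → f x i = f y i

/-- The edges of the template hypergraph `L(X, P)` where `X = Π i, B i`:
the `k`-element subsets of the vertex set that are homomorphic images of `P`. -/
def templateEdges (k : ℕ) {d : ℕ} {A : Type} {B : Fin d → Type}
    (P : Set (Fin d → A)) : Set (Set (∀ i, B i)) :=
  {Q | Q.ncard = k ∧ IsHomImage P Q}

/-- `I` is a distinguisher for `P`: any two distinct members of `P` differ at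
some coordinate in `I`. -/
def IsDistinguisher {d : ℕ} {A : Type} (P : Set (Fin d → A)) (I : Finset (Fin d)) : Prop :=
  ∀ x ∈ P, ∀ y ∈ P, x ≠ y → ∃ i ∈ I, x i ≠ y i

/-- `eDim P = e(P)`, the least cardinality of a distinguisher for `P`. -/
noncomputable def eDim {d : ℕ} {A : Type} (P : Set (Fin d → A)) : ℕ :=
  sInf {e | ∃ I : Finset (Fin d), IsDistinguisher P I ∧ I.card = e}

/-- A `d`-dimensional template is simple if for every `m < d` there are
`x, y ∈ P` with `x i = y i` exactly when `i ≠ m`. -/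
def IsSimple {d : ℕ} {A : Type} (P : Set (Fin d → A)) : Prop :=
  ∀ m : Fin d, ∃ x ∈ P, ∃ y ∈ P, ∀ i, (x i = y i ↔ i ≠ m)

/-- The edges of the zero hypergraph of a `(k, n)`-ary real polynomial:
`k`-element subsets `{a_0, …, a_{k-1}}` of `ℝⁿ` with `p(a_0, …, a_{k-1}) = 0`
for some ordering of the elements. -/
def zeroEdges {n k : ℕ} (p : MvPolynomial (Fin k × Fin n) ℝ) :
    Set (Set (Fin n → ℝ)) :=
  {A | ∃ a : Fin k → (Fin n → ℝ), Function.Injective a ∧ A = Set.range a ∧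
        MvPolynomial.eval (fun q => a q.1 q.2) p = 0}

/-- `H₂ = (V₂, E₂)` contains (a copy of) `H₁ = (V₁, E₁)`: some injection
`V₁ → V₂` maps every edge of `H₁` onto an edge of `H₂`. -/
def HGContains {V₁ V₂ : Type} (E₁ : Set (Set V₁)) (E₂ : Set (Set V₂)) : Prop :=
  ∃ f : V₁ → V₂, Function.Injective f ∧ ∀ e ∈ E₁, f '' e ∈ E₂

theorem cardSucc_add_one (κ : Cardinal) (m : ℕ) :
    cardSucc κ (m + 1) = Order.succ (cardSucc κ m) :=
  Function.iterate_succ_apply' _ _ _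

theorem le_cardSucc (κ : Cardinal) (m : ℕ) : κ ≤ cardSucc κ m := by
  induction m with
  | zero => exact le_rfl
  | succ m ih => exact (ih.trans (Order.le_succ _)).trans_eq (cardSucc_add_one κ m).symm

theorem cardSucc_lt_aleph0 {κ : Cardinal} (hκ : κ < ℵ₀) (m : ℕ) : cardSucc κ m < ℵ₀ := by
  induction m with
  | zero => exact hκ
  | succ m ih =>
    rw [cardSucc_add_one]
    exact isSuccLimit_aleph0.succ_lt ih

/-- A coloring of `X ^ d` with `κ` colors has monochromatic finite grids once `κ^{+d} ≤ #X`. -/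
theorem exists_monochromatic_grid {κ : Cardinal.{0}} (hκ : ℵ₀ ≤ κ) {K : Type} (hK : #K ≤ κ)
    (ι : Type) [Finite ι] (d : ℕ) (X : Type) (hX : cardSucc κ d ≤ #X)
    (φ : (Fin d → X) → K) :
    ∃ (g : Fin d → ι → X) (c : K), (∀ i, Function.Injective (g i)) ∧
      ∀ t : Fin d → ι, φ (fun i => g i (t i)) = c := by
  induction d generalizing X with
  | zero =>
    exact ⟨fun i => i.elim0, φ (fun i => i.elim0), fun i => i.elim0,
      fun t => congrArg φ (Subsingleton.elim _ _)⟩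
  | succ d ih =>
    rw [cardSucc_add_one, Order.succ_le_iff] at hX
    obtain ⟨Y, hY⟩ := Cardinal.le_mk_iff_exists_set.1 hX.le
    have hinf : ℵ₀ ≤ #Y := hY ▸ hκ.trans (le_cardSucc κ d)
    choose g c hg hc using fun x : X =>
      ih Y hY.ge (fun y => φ (Fin.cons x fun i => (y i : X)))
    have : Infinite Y := Cardinal.infinite_iff.2 hinf
    have hcard : #((Fin d → ι → Y) × K) ≤ #Y := by
      rw [Cardinal.mk_prod, Cardinal.lift_id, Cardinal.lift_id]
      refine Cardinal.mul_le_of_le hinf ?_ (hK.trans ((le_cardSucc κ d).trans hY.ge))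
      rw [Cardinal.mk_congr (Equiv.curry (Fin d) ι Y).symm, ← Cardinal.power_def]
      exact Cardinal.pow_le hinf Cardinal.mk_lt_aleph0
    obtain ⟨⟨G, C⟩, hGC⟩ := Cardinal.infinite_pigeonhole_card (fun x => (g x, c x))
      (Order.succ #Y) (Order.succ_le_of_lt (hY ▸ hX)) (hinf.trans (Order.le_succ _))
      (by rw [(Cardinal.isRegular_succ hinf).cof_ord]; exact Order.lt_succ_of_le hcard)
    have hfib : Infinite ((fun x => (g x, c x)) ⁻¹' {(G, C)}) :=
      Cardinal.infinite_iff.2 ((hinf.trans (Order.le_succ _)).trans hGC)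
    obtain ⟨s⟩ : Nonempty (ι ↪ ((fun x => (g x, c x)) ⁻¹' {(G, C)})) := by
      rw [← Cardinal.le_def]
      exact (Cardinal.mk_lt_aleph0.trans_le (Cardinal.aleph0_le_mk _)).le
    refine ⟨Fin.cons (fun j => (s j : X)) fun i j => (G i j : X), C, ?_, fun t => ?_⟩
    · refine Fin.cases ?_ fun i => ?_
      · exact Subtype.val_injective.comp s.injective
      · obtain ⟨x, hx⟩ := Classical.arbitrary ((fun x => (g x, c x)) ⁻¹' {(G, C)})
        obtain ⟨rfl, -⟩ := Prod.mk.inj hx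
        exact Subtype.val_injective.comp (hg x i)
    · obtain ⟨hG, hC⟩ := Prod.mk.inj (s (t 0)).2
      refine Eq.trans ?_ ((hc _ (Fin.tail t)).trans hC)
      congr 1
      refine funext (Fin.cases rfl fun i => ?_)
      simp [hG, Fin.tail]

theorem mk_fin_prod_le (K : Type) [Infinite K] (n : ℕ) : #(Fin n × K) ≤ #K := by
  rw [Cardinal.mk_prod, Cardinal.lift_id, Cardinal.lift_id]
  exact Cardinal.mul_le_of_le (Cardinal.aleph0_le_mk K)
    (Cardinal.mk_lt_aleph0.le.trans (Cardinal.aleph0_le_mk K)) le_rfl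

/-- Kuratowski's free set decomposition, as a coloring: if `#X ≤ κ^{+n}`, then `X ^ (n + 1)` has a
coloring with `κ` colors for each direction such that points of the same color of direction `m`
never lie on a common line in direction `m`. -/
theorem exists_directed_coloring {K : Type} [Infinite K] (n : ℕ) (X : Type)
    (hX : #X ≤ cardSucc #K n) :
    ∃ φ : (Fin (n + 1) → X) → Fin (n + 1) × K, ∀ x y, φ x = φ y →
      (∀ i, i ≠ (φ x).1 → x i = y i) → x = y := by
  induction n generalizing X with
  | zero =>
    obtain ⟨e⟩ := Cardinal.le_def _ _ |>.1 hX
    refine ⟨fun x => (0, e (x 0)), fun x y h _ => funext fun i => ?_⟩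
    rw [Fin.eq_zero i]
    exact e.injective (congrArg Prod.snd h)
  | succ n ih =>
    rw [cardSucc_add_one] at hX
    set μ := cardSucc #K n with hμ
    have hμinf : ℵ₀ ≤ μ := (Cardinal.aleph0_le_mk K).trans (le_cardSucc _ n)
    let Y := (Order.succ μ).ord.ToType
    obtain ⟨e⟩ : Nonempty (X ↪ Y) := by
      rw [← Cardinal.le_def, Cardinal.mk_ord_toType]
      exact hX
    have hseg (a : Y) : #(Set.Iic a) ≤ μ := by
      rw [← Set.Iio_insert]
      refine (Cardinal.mk_insert_le).trans (Cardinal.add_le_of_le hμinf ?_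
        (Cardinal.one_le_aleph0.trans hμinf))
      exact Order.lt_succ_iff.1 ((Cardinal.mk_Iio_lt a (by simp [Y])).trans_eq
        (Cardinal.mk_ord_toType _))
    choose ψ hψ using fun a : Y => ih (Set.Iic a) (hseg a)
    have hmax (x : Fin (n + 2) → X) : ∃ m, ∀ i, e (x i) ≤ e (x m) :=
      Finite.exists_max fun i => e (x i)
    choose m hm using hmax
    obtain ⟨p⟩ : Nonempty (Fin (n + 2) × K ↪ K) := by
      rw [← Cardinal.le_def]
      exact mk_fin_prod_le K _
    let r (x : Fin (n + 2) → X) (i : Fin (n + 1)) : Set.Iic (e (x (m x))) :=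
      ⟨e (x ((m x).succAbove i)), hm x _⟩
    let χ (x : Fin (n + 2) → X) : Fin (n + 1) × K := ψ (e (x (m x))) (r x)
    refine ⟨fun x => ((m x).succAbove (χ x).1, p (m x, (χ x).2)), fun x y h hxy => ?_⟩
    obtain ⟨hdir, hp⟩ := Prod.mk.inj h
    obtain ⟨hmxy, hχ⟩ := Prod.mk.inj (p.injective hp)
    have key (a b : Y) (hab : a = b) (u : Fin (n + 1) → Set.Iic a)
        (v : Fin (n + 1) → Set.Iic b) (huv : ψ a u = ψ b v)
        (hline : ∀ i, i ≠ (ψ a u).1 → (u i : Y) = v i) (i) : (u i : Y) = v i := by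
      subst hab
      exact congrArg Subtype.val
        (congrFun (hψ a u v huv fun i hi => Subtype.ext (hline i hi)) i)
    have hxm : x (m x) = y (m x) := hxy _ (Fin.succAbove_ne _ _).symm
    have hχxy : χ x = χ y := by
      refine Prod.ext (Fin.succAbove_right_injective (p := m x) ?_) hχ
      rw [hdir, hmxy]
    have hr (i : Fin (n + 1)) : x ((m x).succAbove i) = y ((m x).succAbove i) := by
      refine e.injective ?_
      have := key _ _ (by rw [hxm, hmxy]) (r x) (r y) hχxy (fun i hi => by
        change e (x _) = e (y _)
        rw [← hmxy, hxy _ fun h => hi (Fin.succAbove_right_injective h)]) i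
      change e (x _) = e (y _) at this
      rwa [← hmxy] at this
    exact funext ((Fin.forall_iff_succAbove (m x)).2 ⟨hxm, hr⟩)

theorem hgColorable_templateEdges {d k : ℕ} (hd : 1 ≤ d) (hk : 2 ≤ k)
    {P : Set (Fin d → ℝ)} (hP : P.ncard = k) (hsimple : IsSimple P) {κ : Cardinal}
    (h : Cardinal.continuum ≤ cardSucc κ (d - 1)) :
    HGColorable (templateEdges k (B := fun _ : Fin d => ℝ) P) κ := by
  obtain ⟨n, rfl⟩ : ∃ n, d = n + 1 := ⟨d - 1, by omega⟩
  have hκ : ℵ₀ ≤ κ := by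
    by_contra! hlt
    exact absurd (h.trans_lt (cardSucc_lt_aleph0 hlt _)) Cardinal.aleph0_le_continuum.not_gt
  have : Infinite κ.out := by
    rw [Cardinal.infinite_iff, Cardinal.mk_out]
    exact hκ
  obtain ⟨φ, hφ⟩ := exists_directed_coloring (K := κ.out) n ℝ
    (by rw [Cardinal.mk_real, Cardinal.mk_out]; exact h)
  refine ⟨Fin (n + 1) × κ.out, φ, ?_, ?_⟩
  · exact (mk_fin_prod_le κ.out _).trans_eq (Cardinal.mk_out κ)
  · rintro Q ⟨hQk, f, hmaps, hsurj, hf⟩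
    have hPfin : P.Finite := Set.finite_of_ncard_pos (by omega)
    have hinj : Set.InjOn f P := by
      refine Set.injOn_of_ncard_image_eq ?_ hPfin
      rw [hsurj.image_eq_of_mapsTo hmaps, hQk, hP]
    by_contra! hmono
    obtain ⟨x₀, hx₀, -⟩ := hsimple 0
    obtain ⟨x, hx, y, hy, hxy⟩ := hsimple (φ (f x₀)).1
    have hfxy : f x = f y := hφ _ _ (hmono _ (hmaps hx) _ (hmaps hy)) fun i hi =>
      hf x hx y hy i ((hxy i).2 fun h => hi (by
        rw [h, hmono _ (hmaps hx) _ (hmaps hx₀)]))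
    exact (hxy _).1 (congrFun (hinj hx hy hfxy) _) rfl

theorem mem_templateEdges_image {d k : ℕ} {A : Type} {B : Fin d → Type} {P : Set (Fin d → A)}
    (hP : P.ncard = k) (f : (Fin d → A) → ∀ i, B i) (hinj : Set.InjOn f P)
    (hf : ∀ x ∈ P, ∀ y ∈ P, ∀ i, x i = y i → f x i = f y i) :
    f '' P ∈ templateEdges k P :=
  ⟨by rw [hinj.ncard_image, hP], f, Set.mapsTo_image f P, Set.surjOn_image f P, hf⟩

theorem continuum_le_of_hgColorable {d k : ℕ} (hd : 1 ≤ d) (hk : 2 ≤ k)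
    {P : Set (Fin d → ℝ)} (hP : P.ncard = k) {κ : Cardinal}
    (h : HGColorable (templateEdges k (B := fun _ : Fin d => ℝ) P) κ) :
    Cardinal.continuum ≤ cardSucc κ (d - 1) := by
  obtain ⟨n, rfl⟩ : ∃ n, d = n + 1 := ⟨d - 1, by omega⟩
  obtain ⟨K, φ, hK, hφ⟩ := h
  have hPfin : P.Finite := Set.finite_of_ncard_pos (by omega)
  by_contra! hlt
  obtain hκ | hκ := lt_or_ge κ ℵ₀
  · have : Finite K := Cardinal.lt_aleph0_iff_finite.1 (hK.trans_lt hκ)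
    obtain ⟨a, ha, b, c, habc⟩ :=
      Combinatorics.exists_mono_homothetic_copy hPfin.toFinset φ
    obtain ⟨_, ⟨x, hx, rfl⟩, _, ⟨y, hy, rfl⟩, hne⟩ := hφ _
      (mem_templateEdges_image hP (fun s => a • s + b)
        (fun x _ y _ hxy => by
          have : a • x = a • y := add_right_cancel hxy
          exact smul_right_injective _ ha.ne' this)
        (fun x _ y _ i hi => by simp [hi]))
    exact hne ((habc x (by simpa using hx)).trans (habc y (by simpa using hy)).symm)
  · let V : Set ℝ := ⋃ i, (fun x : Fin (n + 1) → ℝ => x i) '' P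
    have hV : V.Finite := Set.finite_iUnion fun i => hPfin.image _
    have hmem {x} (hx : x ∈ P) (i) : x i ∈ V := Set.mem_iUnion.2 ⟨i, x, hx, rfl⟩
    have : Finite V := hV
    obtain ⟨p, hp⟩ : P.Nonempty := Set.nonempty_of_ncard_ne_zero (by omega)
    have : Nonempty V := ⟨⟨p 0, hmem hp 0⟩⟩
    obtain ⟨g, c, hg, hc⟩ := exists_monochromatic_grid hκ hK V (n + 1) ℝ
      (by rw [cardSucc_add_one, Cardinal.mk_real]; exact Order.succ_le_of_lt hlt) φ
    let ρ : ℝ → V := Function.invFun Subtype.val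
    have hρ (v : ℝ) (hv : v ∈ V) : (ρ v : ℝ) = v := Function.invFun_eq ⟨⟨v, hv⟩, rfl⟩
    obtain ⟨_, ⟨x, hx, rfl⟩, _, ⟨y, hy, rfl⟩, hne⟩ := hφ _
      (mem_templateEdges_image hP (fun s i => g i (ρ (s i)))
        (fun x hx y hy hxy => funext fun i => by
          rw [← hρ _ (hmem hx i), ← hρ _ (hmem hy i), hg i (congrFun hxy i)])
        (fun x _ y _ i hi => by simp [hi]))
    exact hne ((hc _).trans (hc _).symm)

/-- Corollary 1.5(a): if `P ⊆ ℝ^d` is a simple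
`d`-dimensional `k`-template, then `χ(L(ℝ^d, P))` is the least cardinal `κ`
with `κ^{+(d-1)} ≥ 2^{ℵ₀}`. -/
theorem statement11 (d k : ℕ) (hd : 1 ≤ d) (hk : 2 ≤ k)
    (P : Set (Fin d → ℝ)) (hP : P.ncard = k) (hsimple : IsSimple P) :
    chrNum (templateEdges k (B := fun _ : Fin d => ℝ) P) =
      sInf {κ : Cardinal | Cardinal.continuum ≤ cardSucc κ (d - 1)} :=
  congrArg sInf (Set.ext fun _ =>
    ⟨continuum_le_of_hgColorable hd hk hP, hgColorable_templateEdges hd hk hP hsimple⟩)
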